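/- Let G be a connected simple graph with adjacency matrix A(G). If G is {P_4, paw, K_5}-free, then the Smith normal form of A(G) has at most 3 invariant factors equal to 1. -/

import Mathlib

/-- The set of `k × k` minors of a matrix. -/
def minorsSet {V W R : Type*} [CommRing R] (M : Matrix V W R) (k : ℕ) : Set R :=
  { d | ∃ (f : Fin k ↪ V) (g : Fin k ↪ W), d = (M.submatrix f g).det }

/-- `phi M` is the number of invariant factors of `M` equal to `1`, i.e. the largest `k`
such that the gcd of all `k × k` minors of `M` is `1`. -/
noncomputable def phi {V W : Type*} (M : Matrix V W ℤ) : ℕ :=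
  sSup {k : ℕ | Ideal.span (minorsSet M k) = ⊤}

/-- The paw graph: a triangle on vertices 1,2,3 with a pendant vertex 0 adjacent to 1. -/
def pawGraph : SimpleGraph (Fin 4) :=
  SimpleGraph.fromRel (fun i j =>
    (i = 0 ∧ j = 1) ∨ (i = 1 ∧ j = 2) ∨ (i = 2 ∧ j = 3) ∨ (i = 1 ∧ j = 3))

lemma adj_or_adj_of_edge {V : Type*} (G : SimpleGraph V) (hconn : G.Connected)
    (hP4 : ¬ Nonempty (SimpleGraph.pathGraph 4 ↪g G))
    (hpaw : ¬ Nonempty (pawGraph ↪g G)) {a b : V} (hab : G.Adj a b) (u : V) :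
    G.Adj u a ∨ G.Adj u b := by
  -- the inductive step, when `x` is adjacent to the first end of the edge
  have key : ∀ a b x y : V, G.Adj a b → G.Adj x a → G.Adj x y → ¬ G.Adj y a →
      ¬ G.Adj y b → False := by
    intro a b x y hab hxa hxy hya hyb
    have hxb : x ≠ b := by rintro rfl; exact hyb hxy.symm
    have hya' : y ≠ a := by rintro rfl; exact hyb hab
    have hyb' : y ≠ b := by rintro rfl; exact hya hab.symm
    have inj : Function.Injective ![y, x, a, b] := by
      have h1 := hxy.ne
      have h2 := hxa.ne
      have h3 := hab.ne
      intro i j h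
      fin_cases i <;> fin_cases j <;> simp_all [eq_comm]
    by_cases hxb2 : G.Adj x b
    · refine hpaw ⟨⟨⟨![y, x, a, b], inj⟩, ?_⟩⟩
      intro i j
      fin_cases i <;> fin_cases j <;>
        simp [pawGraph, hab, hxa, hxy, hya, hyb, hxb2, G.adj_comm b a, G.adj_comm a x,
          G.adj_comm y x, G.adj_comm a y, G.adj_comm b y, G.adj_comm b x]
    · refine hP4 ⟨⟨⟨![y, x, a, b], inj⟩, ?_⟩⟩
      intro i j
      fin_cases i <;> fin_cases j <;>
        simp [SimpleGraph.pathGraph_adj, hab, hxa, hxy, hya, hyb, hxb2, G.adj_comm b a,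
          G.adj_comm a x, G.adj_comm y x, G.adj_comm a y, G.adj_comm b y, G.adj_comm b x]
  obtain ⟨p⟩ := hconn.preconnected u a
  induction p with
  | nil => exact Or.inr hab
  | cons h p ih =>
    by_contra hcon
    rw [not_or] at hcon
    rcases ih hab with h1 | h1
    · exact key _ _ _ _ hab h1 h.symm hcon.1 hcon.2
    · exact key _ _ _ _ hab.symm h1 h.symm hcon.2 hcon.1

lemma exists_four_parts {V : Type*} (G : SimpleGraph V) [Finite V]
    (h : ∀ a b u, G.Adj a b → G.Adj u a ∨ G.Adj u b)
    (hK5 : ¬ Nonempty ((⊤ : SimpleGraph (Fin 5)) ↪g G)) :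
    ∃ p : V → Fin 4, ∀ u v, G.Adj u v ↔ p u ≠ p v := by
  classical
  let s : Setoid V := ⟨fun u v => ¬ G.Adj u v, fun u => G.irrefl,
    fun h1 h2 => h1 h2.symm, fun {x y z} h1 h2 h3 => by
      rcases h _ _ y h3 with h4 | h4
      · exact h1 h4.symm
      · exact h2 h4⟩
  have hs : ∀ u v, (Quotient.mk s u = Quotient.mk s v) ↔ ¬ G.Adj u v := fun u v => Quotient.eq
  have : Fintype (Quotient s) := Fintype.ofFinite _
  by_cases hc : Fintype.card (Quotient s) ≤ 4
  · obtain ⟨e⟩ : Nonempty (Quotient s ↪ Fin 4) :=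
      Function.Embedding.nonempty_of_card_le (by simpa using hc)
    refine ⟨fun u => e (Quotient.mk s u), fun u v => ?_⟩
    rw [Ne, e.injective.eq_iff, hs, not_not]
  · obtain ⟨e⟩ : Nonempty (Fin 5 ↪ Quotient s) :=
      Function.Embedding.nonempty_of_card_le (by simp; omega)
    refine absurd ⟨⟨⟨fun i => (e i).out, fun i j hij => ?_⟩, ?_⟩⟩ hK5
    · exact e.injective (Quotient.out_injective hij)
    · intro i j
      have := hs (e i).out (e j).out
      rw [Quotient.out_eq, Quotient.out_eq, e.injective.eq_iff] at this
      change G.Adj (e i).out (e j).out ↔ _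
      rw [SimpleGraph.top_adj, Ne, this, not_not]

/-- Left factor of `J - I` modulo 3. -/
def leftFac (i : Fin 4) (j : Fin 3) : ZMod 3 := if j.castSucc = i then 0 else 1

/-- Right factor of `J - I` modulo 3. -/
def rightFac (j : Fin 3) (i : Fin 4) : ZMod 3 :=
  if i = j.castSucc then 1 else if i = 3 then -1 else 0

lemma fac_mul : ∀ i k : Fin 4, ∑ j, leftFac i j * rightFac j k = if i ≠ k then 1 else 0 := by
  decide

theorem phi_le_three_of_P4_paw_K5_free {V : Type*} [Fintype V] [DecidableEq V]
    (G : SimpleGraph V) [DecidableRel G.Adj] (hconn : G.Connected)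
    (hP4 : ¬ Nonempty (SimpleGraph.pathGraph 4 ↪g G))
    (hpaw : ¬ Nonempty (pawGraph ↪g G))
    (hK5 : ¬ Nonempty ((⊤ : SimpleGraph (Fin 5)) ↪g G)) :
    phi (G.adjMatrix ℤ) ≤ 3 := by
  obtain ⟨p, hp⟩ := exists_four_parts G
    (fun a b u hab => adj_or_adj_of_edge G hconn hP4 hpaw hab u) hK5
  refine csSup_le' ?_
  intro k hk
  by_contra hk3
  have hk : Ideal.span (minorsSet (G.adjMatrix ℤ) k) = ⊤ := hk
  have hle : Ideal.span (minorsSet (G.adjMatrix ℤ) k) ≤ RingHom.ker (Int.castRingHom (ZMod 3)) := by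
    rw [Ideal.span_le]
    rintro d ⟨f, g, rfl⟩
    rw [SetLike.mem_coe, RingHom.mem_ker, RingHom.map_det]
    have hfac : (Int.castRingHom (ZMod 3)).mapMatrix ((G.adjMatrix ℤ).submatrix f g) =
        (Matrix.of fun (i : Fin k) j => leftFac (p (f i)) j) *
          (Matrix.of fun j (i : Fin k) => rightFac j (p (g i))) := by
      ext i j
      rw [Matrix.mul_apply]
      simp only [Matrix.of_apply]
      rw [fac_mul]
      simp [SimpleGraph.adjMatrix_apply, hp]
    rw [hfac]
    by_contra hdet
    have : Fact (Nat.Prime 3) := ⟨Nat.prime_three⟩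
    have hr := Matrix.rank_of_isUnit _ ((Matrix.isUnit_iff_isUnit_det _).2 (Ne.isUnit hdet))
    have hr2 := (Matrix.rank_mul_le_left
      (Matrix.of fun (i : Fin k) j => leftFac (p (f i)) j)
      (Matrix.of fun j (i : Fin k) => rightFac j (p (g i)))).trans (Matrix.rank_le_width _)
    rw [hr, Fintype.card_fin] at hr2
    exact hk3 hr2
  rw [hk] at hle
  have h1 : (1 : ℤ) ∈ RingHom.ker (Int.castRingHom (ZMod 3)) := hle trivial
  rw [RingHom.mem_ker, map_one] at h1
  exact one_ne_zero h1
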